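/- Let (f,g,h) be a map of triangles from a distinguished triangle X →u Y →v Z →w ΣX to a distinguished triangle X' →u' Y' →v' Z' →w' ΣX' in which at least one of the three components f, g, h is the zero morphism. Then (f,g,h) is nullhomotopic if and only if it is good. If moreover the map has the form (0, g, h) or (f, 0, h) (i.e., f = 0 or g = 0), then these conditions are also equivalent to (f,g,h) being Verdier good. -/

import Mathlib

open CategoryTheory Category Limits Pretriangulated

universe v u

variable {C : Type u} [Category.{v} C] [Preadditive C] [HasZeroObject C]
  [HasShift C ℤ] [∀ n : ℤ, (shiftFunctor C n).Additive] [Pretriangulated C]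
  [IsTriangulated C] [HasBinaryBiproducts C]

noncomputable local instance (n : ℤ) : PreservesBinaryBiproducts (shiftFunctor C n) :=
  preservesBinaryBiproducts_of_preservesBiproducts _

/-- The condition that `(f, g, h)` is a morphism of triangles from `T` to `T'`. -/
def IsTriMap (T T' : Triangle C) (f : T.obj₁ ⟶ T'.obj₁) (g : T.obj₂ ⟶ T'.obj₂)
    (h : T.obj₃ ⟶ T'.obj₃) : Prop :=
  T.mor₁ ≫ g = f ≫ T'.mor₁ ∧ T.mor₂ ≫ h = g ≫ T'.mor₂ ∧
    T.mor₃ ≫ f⟦(1 : ℤ)⟧' = h ≫ T'.mor₃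

/-- The mapping cone of a morphism of triangles. -/
noncomputable def mappingCone (T T' : Triangle C) (f : T.obj₁ ⟶ T'.obj₁)
    (g : T.obj₂ ⟶ T'.obj₂) (h : T.obj₃ ⟶ T'.obj₃) : Triangle C :=
  Triangle.mk
    (biprod.desc (biprod.lift T'.mor₁ 0) (biprod.lift g (-T.mor₂)) :
      T'.obj₁ ⊞ T.obj₂ ⟶ T'.obj₂ ⊞ T.obj₃)
    (biprod.desc (biprod.lift T'.mor₂ 0) (biprod.lift h (-T.mor₃)) :
      T'.obj₂ ⊞ T.obj₃ ⟶ T'.obj₃ ⊞ T.obj₁⟦(1 : ℤ)⟧)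
    (biprod.desc (biprod.lift T'.mor₃ 0)
        (biprod.lift (f⟦(1 : ℤ)⟧') (-(T.mor₁⟦(1 : ℤ)⟧'))) ≫
      ((shiftFunctor C (1 : ℤ)).mapBiprod T'.obj₁ T.obj₂).inv)

/-- A morphism of triangles is good if its mapping cone is distinguished. -/
noncomputable def IsGood (T T' : Triangle C) (f : T.obj₁ ⟶ T'.obj₁)
    (g : T.obj₂ ⟶ T'.obj₂) (h : T.obj₃ ⟶ T'.obj₃) : Prop :=
  mappingCone T T' f g h ∈ distTriang C

/-- An octahedron on composable maps `a`, `b`, given distinguished triangles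
`(a, p₁, q₁)`, `(b, p₂, q₂)` and `(a ≫ b, p₃, q₃)`, is a pair `(m, n)` as below. -/
def IsOctahedron {A₁ A₂ A₃ B₁ B₂ B₃ : C} (a : A₁ ⟶ A₂) (b : A₂ ⟶ A₃)
    (p₁ : A₂ ⟶ B₁) (q₁ : B₁ ⟶ A₁⟦(1 : ℤ)⟧)
    (p₂ : A₃ ⟶ B₂) (q₂ : B₂ ⟶ A₂⟦(1 : ℤ)⟧)
    (p₃ : A₃ ⟶ B₃) (q₃ : B₃ ⟶ A₁⟦(1 : ℤ)⟧)
    (m : B₁ ⟶ B₃) (n : B₃ ⟶ B₂) : Prop :=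
  p₁ ≫ m = b ≫ p₃ ∧ m ≫ q₃ = q₁ ∧ p₃ ≫ n = p₂ ∧ n ≫ q₂ = q₃ ≫ a⟦(1 : ℤ)⟧' ∧
    (Triangle.mk m n (q₂ ≫ p₁⟦(1 : ℤ)⟧') ∈ distTriang C)

/-- A morphism of triangles `(f, g, h)` is Verdier good if `h` arises from Verdier's
construction via two octahedra on the composite `g ∘ u = u' ∘ f`. -/
def IsVerdierGood (T T' : Triangle C) (f : T.obj₁ ⟶ T'.obj₁) (g : T.obj₂ ⟶ T'.obj₂)
    (h : T.obj₃ ⟶ T'.obj₃) : Prop :=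
  ∃ (A Y'' X'' : C) (vt : T'.obj₂ ⟶ A) (wt : A ⟶ T.obj₁⟦(1 : ℤ)⟧)
    (g' : T'.obj₂ ⟶ Y'') (g'' : Y'' ⟶ T.obj₂⟦(1 : ℤ)⟧)
    (f' : T'.obj₁ ⟶ X'') (f'' : X'' ⟶ T.obj₁⟦(1 : ℤ)⟧)
    (α₁ : T.obj₃ ⟶ A) (β₁ : A ⟶ Y'') (α₂ : X'' ⟶ A) (β₂ : A ⟶ T'.obj₃),
    (Triangle.mk (T.mor₁ ≫ g) vt wt ∈ distTriang C) ∧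
    (Triangle.mk g g' g'' ∈ distTriang C) ∧
    (Triangle.mk f f' f'' ∈ distTriang C) ∧
    IsOctahedron T.mor₁ g T.mor₂ T.mor₃ g' g'' vt wt α₁ β₁ ∧
    IsOctahedron f T'.mor₁ f' f'' T'.mor₂ T'.mor₃ vt wt α₂ β₂ ∧
    h = α₁ ≫ β₂

/-- The morphism of triangles `(f, g, h)` is nullhomotopic, in the (equivalent)
`Σ`-applied formulation of the first equation. -/
def IsNullHomotopic (T T' : Triangle C) (f : T.obj₁ ⟶ T'.obj₁) (g : T.obj₂ ⟶ T'.obj₂)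
    (h : T.obj₃ ⟶ T'.obj₃) : Prop :=
  ∃ (F : T.obj₂ ⟶ T'.obj₁) (G : T.obj₃ ⟶ T'.obj₂) (H : T.obj₁⟦(1 : ℤ)⟧ ⟶ T'.obj₃),
    f⟦(1 : ℤ)⟧' = T.mor₁⟦(1 : ℤ)⟧' ≫ F⟦(1 : ℤ)⟧' + H ≫ T'.mor₃ ∧
    g = T.mor₂ ≫ G + F ≫ T'.mor₁ ∧
    h = T.mor₃ ≫ H + G ≫ T'.mor₂

/-- A triangle is contractible if its identity morphism is nullhomotopic. -/
def IsContractible (T : Triangle C) : Prop :=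
  IsNullHomotopic T T (𝟙 T.obj₁) (𝟙 T.obj₂) (𝟙 T.obj₃)

/-- A morphism of triangles is middling good if it extends to a 4 × 4 diagram. -/
def IsMiddlingGood (T T' : Triangle C) (f : T.obj₁ ⟶ T'.obj₁) (g : T.obj₂ ⟶ T'.obj₂)
    (h : T.obj₃ ⟶ T'.obj₃) : Prop :=
  ∃ (X'' Y'' Z'' : C)
    (f' : T'.obj₁ ⟶ X'') (f'' : X'' ⟶ T.obj₁⟦(1 : ℤ)⟧)
    (g' : T'.obj₂ ⟶ Y'') (g'' : Y'' ⟶ T.obj₂⟦(1 : ℤ)⟧)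
    (h' : T'.obj₃ ⟶ Z'') (h'' : Z'' ⟶ T.obj₃⟦(1 : ℤ)⟧)
    (u'' : X'' ⟶ Y'') (v'' : Y'' ⟶ Z'') (w'' : Z'' ⟶ X''⟦(1 : ℤ)⟧),
    (Triangle.mk f f' f'' ∈ distTriang C) ∧
    (Triangle.mk g g' g'' ∈ distTriang C) ∧
    (Triangle.mk h h' h'' ∈ distTriang C) ∧
    (Triangle.mk u'' v'' w'' ∈ distTriang C) ∧
    T'.mor₁ ≫ g' = f' ≫ u'' ∧
    T'.mor₂ ≫ h' = g' ≫ v'' ∧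
    T'.mor₃ ≫ f'⟦(1 : ℤ)⟧' = h' ≫ w'' ∧
    u'' ≫ g'' = f'' ≫ T.mor₁⟦(1 : ℤ)⟧' ∧
    v'' ≫ h'' = g'' ≫ T.mor₂⟦(1 : ℤ)⟧' ∧
    h'' ≫ T.mor₃⟦(1 : ℤ)⟧' = -(w'' ≫ f''⟦(1 : ℤ)⟧')

/-- A candidate triangle `(a, b, c)` is replaceably exact if each of its three maps
can be replaced to give a distinguished triangle. -/
def ReplaceablyExact {A B D : C} (a : A ⟶ B) (b : B ⟶ D) (c : D ⟶ A⟦(1 : ℤ)⟧) : Prop :=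
  (∃ a' : A ⟶ B, Triangle.mk a' b c ∈ distTriang C) ∧
  (∃ b' : B ⟶ D, Triangle.mk a b' c ∈ distTriang C) ∧
  (∃ c' : D ⟶ A⟦(1 : ℤ)⟧, Triangle.mk a b c' ∈ distTriang C)

set_option linter.unusedSectionVars false

section Biproducts

variable {D : Type*} [Category D] [Preadditive D] [HasBinaryBiproducts D]

lemma biprod_desc_lift_comp_unipotentLower {A B P Q : D} (a : A ⟶ P) (b : B ⟶ P) (c : B ⟶ Q)
    (r : Q ⟶ P) :
    biprod.desc (biprod.lift a 0) (biprod.lift b c) ≫ (Biprod.unipotentLower r).hom =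
      biprod.desc (biprod.lift a 0) (biprod.lift (b + c ≫ r) c) := by
  ext <;> simp

lemma inl_unipotentLower {A B : D} (r : B ⟶ A) :
    biprod.inl ≫ (Biprod.unipotentLower r).hom = biprod.inl := by simp

lemma inr_unipotentLower {A B : D} (r : B ⟶ A) :
    biprod.inr ≫ (Biprod.unipotentLower r).hom = r ≫ biprod.inl + biprod.inr := by simp

lemma biprod_unipotentLower_comp_desc_lift {A B P Q : D} (a : A ⟶ P) (b : B ⟶ P) (c : B ⟶ Q)
    (r : B ⟶ A) :
    (Biprod.unipotentLower r).hom ≫ biprod.desc (biprod.lift a 0) (biprod.lift b c) =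
      biprod.desc (biprod.lift a 0) (biprod.lift (r ≫ a + b) c) := by
  apply biprod.hom_ext'
  · rw [reassoc_of% inl_unipotentLower]; simp
  · rw [reassoc_of% inr_unipotentLower]; ext <;> simp

end Biproducts

section NullHomotopy

variable {T T' : Triangle C}

lemma isNullHomotopic_of_sub {f₁ f₂ : T.obj₁ ⟶ T'.obj₁} {g₁ g₂ : T.obj₂ ⟶ T'.obj₂}
    {h₁ h₂ : T.obj₃ ⟶ T'.obj₃} (hs : IsNullHomotopic T T' (f₁ - f₂) (g₁ - g₂) (h₁ - h₂))
    (hn : IsNullHomotopic T T' f₂ g₂ h₂) : IsNullHomotopic T T' f₁ g₁ h₁ := by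
  obtain ⟨F, G, H, e₁, e₂, e₃⟩ := hs
  obtain ⟨F', G', H', e₁', e₂', e₃'⟩ := hn
  refine ⟨F + F', G + G', H + H', ?_, ?_, ?_⟩
  · rw [Functor.map_sub, sub_eq_iff_eq_add] at e₁
    rw [e₁, e₁', Functor.map_add, Preadditive.comp_add, Preadditive.add_comp]
    abel
  · rw [sub_eq_iff_eq_add] at e₂
    rw [e₂, e₂', Preadditive.comp_add, Preadditive.add_comp]
    abel
  · rw [sub_eq_iff_eq_add] at e₃
    rw [e₃, e₃', Preadditive.comp_add, Preadditive.add_comp]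
    abel

lemma mapBiprod_inv_map_fst {A B : C} :
    ((shiftFunctor C (1 : ℤ)).mapBiprod A B).inv ≫ (shiftFunctor C (1 : ℤ)).map biprod.fst =
      biprod.fst := by
  rw [Iso.inv_comp_eq, Functor.mapBiprod_hom, biprod.lift_fst]

lemma mapBiprod_inv_map_snd {A B : C} :
    ((shiftFunctor C (1 : ℤ)).mapBiprod A B).inv ≫ (shiftFunctor C (1 : ℤ)).map biprod.snd =
      biprod.snd := by
  rw [Iso.inv_comp_eq, Functor.mapBiprod_hom, biprod.lift_snd]

lemma shift_map_unipotentLower_mapBiprod {A B : C} (r : B ⟶ A) :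
    ((shiftFunctor C (1 : ℤ)).mapBiprod A B).inv ≫
        (shiftFunctor C (1 : ℤ)).map (Biprod.unipotentLower r).hom =
      (Biprod.unipotentLower (r⟦(1 : ℤ)⟧')).hom ≫
        ((shiftFunctor C (1 : ℤ)).mapBiprod A B).inv := by
  apply biprod.hom_ext'
  · simp only [Functor.mapBiprod_inv, biprod.inl_desc_assoc,
      reassoc_of% inl_unipotentLower (r⟦(1 : ℤ)⟧'), ← Functor.map_comp,
      inl_unipotentLower, biprod.inl_desc]
  · simp only [Functor.mapBiprod_inv, biprod.inr_desc_assoc,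
      reassoc_of% inr_unipotentLower (r⟦(1 : ℤ)⟧'), ← Functor.map_comp,
      inr_unipotentLower, biprod.inr_desc, biprod.inl_desc, Preadditive.add_comp, assoc,
      Functor.map_add]

/-- Homotopic maps of triangles have isomorphic mapping cones. -/
lemma isGood_of_isNullHomotopic_sub {f₁ f₂ : T.obj₁ ⟶ T'.obj₁} {g₁ g₂ : T.obj₂ ⟶ T'.obj₂}
    {h₁ h₂ : T.obj₃ ⟶ T'.obj₃} (hn : IsNullHomotopic T T' (f₁ - f₂) (g₁ - g₂) (h₁ - h₂))
    (hg : IsGood T T' f₁ g₁ h₁) : IsGood T T' f₂ g₂ h₂ := by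
  obtain ⟨F, G, H, e₁, e₂, e₃⟩ := hn
  rw [Functor.map_sub, sub_eq_iff_eq_add] at e₁
  rw [sub_eq_iff_eq_add] at e₂ e₃
  refine isomorphic_distinguished _ hg _ (Iso.symm ?_)
  refine Triangle.isoMk _ _ (Biprod.unipotentLower F) (Biprod.unipotentLower G)
    (Biprod.unipotentLower H) ?_ ?_ ?_
  · dsimp only [mappingCone, Triangle.mk]
    rw [biprod_desc_lift_comp_unipotentLower, biprod_unipotentLower_comp_desc_lift, e₂,
      Preadditive.neg_comp]
    congr 2
    abel
  · dsimp only [mappingCone, Triangle.mk]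
    rw [biprod_desc_lift_comp_unipotentLower, biprod_unipotentLower_comp_desc_lift, e₃,
      Preadditive.neg_comp]
    congr 2
    abel
  · dsimp only [mappingCone, Triangle.mk]
    rw [assoc, shift_map_unipotentLower_mapBiprod,
      reassoc_of% biprod_desc_lift_comp_unipotentLower,
      reassoc_of% biprod_unipotentLower_comp_desc_lift, e₁, Preadditive.neg_comp]
    congr 3
    abel

lemma isNullHomotopic_neg {f : T.obj₁ ⟶ T'.obj₁} {g : T.obj₂ ⟶ T'.obj₂}
    {h : T.obj₃ ⟶ T'.obj₃} (hn : IsNullHomotopic T T' f g h) :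
    IsNullHomotopic T T' (-f) (-g) (-h) := by
  obtain ⟨F, G, H, e₁, e₂, e₃⟩ := hn
  refine ⟨-F, -G, -H, ?_, ?_, ?_⟩
  · rw [Functor.map_neg, e₁, Functor.map_neg, Preadditive.comp_neg, Preadditive.neg_comp, neg_add]
  · rw [e₂, Preadditive.comp_neg, Preadditive.neg_comp, neg_add]
  · rw [e₃, Preadditive.comp_neg, Preadditive.neg_comp, neg_add]

lemma neg_rotate_distinguished (hT : T ∈ distTriang C) :
    Triangle.mk (-T.mor₂) (-T.mor₃) (-(T.mor₁⟦(1 : ℤ)⟧')) ∈ distTriang C := by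
  let e : T.obj₃ ≅ T.obj₃ := ⟨-𝟙 _, -𝟙 _, by simp, by simp⟩
  refine isomorphic_distinguished _ (rot_of_distTriang _ hT) _ ?_
  refine Triangle.isoMk _ _ (Iso.refl T.obj₂) e (Iso.refl (T.obj₁⟦(1 : ℤ)⟧)) ?_ ?_ ?_
  · change (-T.mor₂) ≫ (-𝟙 T.obj₃) = 𝟙 T.obj₂ ≫ T.mor₂
    simp
  · change (-T.mor₃) ≫ 𝟙 (T.obj₁⟦(1 : ℤ)⟧) = (-𝟙 T.obj₃) ≫ T.mor₃
    simp
  · change (-(T.mor₁⟦(1 : ℤ)⟧')) ≫ (𝟙 T.obj₂)⟦(1 : ℤ)⟧' =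
      𝟙 (T.obj₁⟦(1 : ℤ)⟧) ≫ (-(T.mor₁⟦(1 : ℤ)⟧'))
    simp

lemma distinguished_of_biproduct {T₁ T₂ P : Triangle C} (h₁ : T₁ ∈ distTriang C)
    (h₂ : T₂ ∈ distTriang C) (p : P ⟶ T₁) (q : P ⟶ T₂)
    (i₁ : IsIso (biprod.lift p.hom₁ q.hom₁)) (i₂ : IsIso (biprod.lift p.hom₂ q.hom₂))
    (i₃ : IsIso (biprod.lift p.hom₃ q.hom₃)) : P ∈ distTriang C := by
  let S : WalkingPair → Triangle C := fun j => WalkingPair.casesOn j T₁ T₂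
  have hS : ∀ j, S j ∈ distTriang C := by rintro (_ | _); exacts [h₁, h₂]
  let φ : ∀ j, P ⟶ S j := fun j => WalkingPair.rec (motive := fun j => P ⟶ S j) p q j
  have key : ∀ {A : C} {B : WalkingPair → C} (ψ : ∀ j, A ⟶ B j),
      IsIso (biprod.lift (ψ .left) (ψ .right)) → IsIso (Pi.lift ψ) := by
    intro A B ψ hψ
    let e : B .left ⊞ B .right ≅ ∏ᶜ B :=
      { hom := Pi.lift (fun j => WalkingPair.rec (motive := fun j => B .left ⊞ B .right ⟶ B j)
          biprod.fst biprod.snd j)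
        inv := biprod.lift (Pi.π _ _) (Pi.π _ _)
        hom_inv_id := by ext <;> simp
        inv_hom_id := by
          apply Pi.hom_ext
          rintro (_ | _) <;> simp }
    have : Pi.lift ψ = biprod.lift (ψ .left) (ψ .right) ≫ e.hom := by
      apply Pi.hom_ext
      rintro (_ | _) <;> simp [e]
    rw [this]
    exact IsIso.comp_isIso' hψ e.isIso_hom
  have : IsIso (productTriangle.lift S φ) := by
    apply Triangle.isIso_of_isIsos
    · exact key (fun j => (φ j).hom₁) i₁
    · exact key (fun j => (φ j).hom₂) i₂
    · exact key (fun j => (φ j).hom₃) i₃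
  exact isomorphic_distinguished _ (productTriangle_distinguished S hS) _
    (asIso (productTriangle.lift S φ))

lemma isGood_zero (hT : T ∈ distTriang C) (hT' : T' ∈ distTriang C) : IsGood T T' 0 0 0 := by
  have h1 : ∀ {A B : C}, IsIso (biprod.lift (biprod.fst : A ⊞ B ⟶ A) biprod.snd) := by
    intro A B
    rw [show biprod.lift (biprod.fst : A ⊞ B ⟶ A) biprod.snd = 𝟙 _ by ext <;> simp]
    infer_instance
  refine distinguished_of_biproduct hT' (neg_rotate_distinguished hT)
    (Triangle.homMk _ _ biprod.fst biprod.fst biprod.fst ?_ ?_ ?_)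
    (Triangle.homMk _ _ biprod.snd biprod.snd biprod.snd ?_ ?_ ?_) h1 h1 h1
  all_goals
    dsimp only [mappingCone, Triangle.mk]
    apply biprod.hom_ext' <;>
      simp only [biprod.inl_desc_assoc, biprod.inr_desc_assoc, biprod.lift_fst, biprod.lift_snd,
        biprod.inl_fst_assoc, biprod.inl_snd_assoc, biprod.inr_fst_assoc, biprod.inr_snd_assoc,
        assoc, mapBiprod_inv_map_fst, mapBiprod_inv_map_snd, Functor.map_zero, zero_comp]

lemma isGood_of_isNullHomotopic (hT : T ∈ distTriang C) (hT' : T' ∈ distTriang C)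
    {f : T.obj₁ ⟶ T'.obj₁} {g : T.obj₂ ⟶ T'.obj₂} {h : T.obj₃ ⟶ T'.obj₃}
    (hn : IsNullHomotopic T T' f g h) : IsGood T T' f g h :=
  isGood_of_isNullHomotopic_sub (by simpa using isNullHomotopic_neg hn) (isGood_zero hT hT')

lemma exists_factorization_of_isGood_zero_zero (hT : T ∈ distTriang C) (hT' : T' ∈ distTriang C)
    {h : T.obj₃ ⟶ T'.obj₃} (hg : IsGood T T' 0 0 h) :
    ∃ H : T.obj₁⟦(1 : ℤ)⟧ ⟶ T'.obj₃, h = T.mor₃ ≫ H ∧ H ≫ T'.mor₃ = 0 := by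
  obtain ⟨c, hc₂, hc₃⟩ := complete_distinguished_triangle_morphism _ _ (isGood_zero hT hT') hg
    (𝟙 (T'.obj₁ ⊞ T.obj₂)) (𝟙 (T'.obj₂ ⊞ T.obj₃)) ((comp_id _).trans (id_comp _).symm)
  change T'.obj₃ ⊞ T.obj₁⟦(1 : ℤ)⟧ ⟶ T'.obj₃ ⊞ T.obj₁⟦(1 : ℤ)⟧ at c
  dsimp only [mappingCone, Triangle.mk] at hc₂ hc₃
  rw [CategoryTheory.Functor.map_id, comp_id, ← assoc, cancel_mono] at hc₃
  rw [id_comp] at hc₂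
  refine ⟨-(biprod.inr ≫ c ≫ biprod.fst), ?_, ?_⟩
  · have := biprod.inr ≫= hc₂ =≫ biprod.fst
    simpa [biprod.lift_eq] using this.symm
  · have := biprod.inr ≫= hc₃ =≫ biprod.fst
    have e : c = (c ≫ biprod.fst) ≫ biprod.inl + (c ≫ biprod.snd) ≫ biprod.inr := by
      ext <;> simp
    rw [e] at this
    simpa using this.symm

lemma isNullHomotopic_of_isGood_right_zero (hT : T ∈ distTriang C) (hT' : T' ∈ distTriang C)
    {f : T.obj₁ ⟶ T'.obj₁} (hg : IsGood T T' f 0 0) : IsNullHomotopic T T' f 0 0 := by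
  obtain ⟨c, hc₁, hc₃⟩ := complete_distinguished_triangle_morphism₁ _ _ (isGood_zero hT hT') hg
    (𝟙 (T'.obj₂ ⊞ T.obj₃)) (𝟙 (T'.obj₃ ⊞ T.obj₁⟦(1 : ℤ)⟧)) ((comp_id _).trans (id_comp _).symm)
  change T'.obj₁ ⊞ T.obj₂ ⟶ T'.obj₁ ⊞ T.obj₂ at c
  dsimp only [mappingCone, Triangle.mk] at hc₁ hc₃
  rw [comp_id] at hc₁
  rw [id_comp] at hc₃
  refine ⟨-(biprod.inr ≫ c ≫ biprod.fst), 0, 0, ?_, ?_, by simp⟩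
  · have := biprod.inr ≫= hc₃ =≫ (shiftFunctor C (1 : ℤ)).map biprod.fst
    simp only [Functor.mapBiprod_inv, assoc, biprod.inr_desc_assoc, biprod.lift_desc_assoc,
      Preadditive.add_comp, Preadditive.neg_comp, ← Functor.map_comp] at this
    simpa using this.symm
  · have := biprod.inr ≫= hc₁ =≫ biprod.fst
    have e : c = (c ≫ biprod.fst) ≫ biprod.inl + (c ≫ biprod.snd) ≫ biprod.inr := by
      ext <;> simp
    rw [e] at this
    simpa using this.symm

/-- A good map of triangles whose first square has zero diagonal has a homotopy to zero
with vanishing component `T.obj₂ ⟶ T'.obj₁`. -/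
lemma exists_homotopy_of_isGood (hT : T ∈ distTriang C) (hT' : T' ∈ distTriang C)
    {f : T.obj₁ ⟶ T'.obj₁} {g : T.obj₂ ⟶ T'.obj₂} {h : T.obj₃ ⟶ T'.obj₃}
    (hug : T.mor₁ ≫ g = 0) (hfu : f ≫ T'.mor₁ = 0) (hg : IsGood T T' f g h) :
    ∃ (G : T.obj₃ ⟶ T'.obj₂) (H : T.obj₁⟦(1 : ℤ)⟧ ⟶ T'.obj₃),
      f⟦(1 : ℤ)⟧' = H ≫ T'.mor₃ ∧ g = T.mor₂ ≫ G ∧ h = T.mor₃ ≫ H + G ≫ T'.mor₂ := by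
  obtain ⟨G, hG⟩ := T.yoneda_exact₂ hT g hug
  obtain ⟨H₀, hH₀⟩ := T'.coyoneda_exact₁ hT' (f⟦(1 : ℤ)⟧') (by rw [← Functor.map_comp, hfu,
    Functor.map_zero])
  obtain ⟨H, hH, hH'⟩ := exists_factorization_of_isGood_zero_zero hT hT'
    (h := h - (T.mor₃ ≫ H₀ + G ≫ T'.mor₂)) (isGood_of_isNullHomotopic_sub
      ⟨0, G, H₀, by simpa using hH₀, by simpa using hG, by simp⟩ hg)
  refine ⟨G, H + H₀, ?_, hG, ?_⟩
  · rw [Preadditive.add_comp, hH', zero_add, hH₀]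
  · rw [sub_eq_iff_eq_add] at hH
    rw [hH, Preadditive.comp_add, add_assoc]

lemma isNullHomotopic_iff_isGood_of_zero_diagonal (hT : T ∈ distTriang C)
    (hT' : T' ∈ distTriang C)
    {f : T.obj₁ ⟶ T'.obj₁} {g : T.obj₂ ⟶ T'.obj₂} {h : T.obj₃ ⟶ T'.obj₃}
    (hug : T.mor₁ ≫ g = 0) (hfu : f ≫ T'.mor₁ = 0) :
    IsNullHomotopic T T' f g h ↔ IsGood T T' f g h := by
  refine ⟨isGood_of_isNullHomotopic hT hT', fun hg => ?_⟩
  obtain ⟨G, H, e₁, e₂, e₃⟩ := exists_homotopy_of_isGood hT hT' hug hfu hg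
  exact ⟨0, G, H, by simpa using e₁, by simpa using e₂, e₃⟩

lemma isNullHomotopic_iff_isGood_of_third_zero (hT : T ∈ distTriang C)
    (hT' : T' ∈ distTriang C)
    {f : T.obj₁ ⟶ T'.obj₁} {g : T.obj₂ ⟶ T'.obj₂} (hgv : g ≫ T'.mor₂ = 0) :
    IsNullHomotopic T T' f g 0 ↔ IsGood T T' f g 0 := by
  refine ⟨isGood_of_isNullHomotopic hT hT', fun hg => ?_⟩
  obtain ⟨F, hF⟩ := T'.coyoneda_exact₂ hT' g hgv
  have hn : IsNullHomotopic T T' (f - (f - T.mor₁ ≫ F)) (g - 0) (0 - 0) :=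
    ⟨F, 0, 0, by simp, by simpa using hF, by simp⟩
  exact isNullHomotopic_of_sub hn (isNullHomotopic_of_isGood_right_zero hT hT'
    (isGood_of_isNullHomotopic_sub hn hg))

end NullHomotopy

section VerdierGood

lemma exists_splitting_of_distinguished_zero {X Y A : C} {i : Y ⟶ A} {p : A ⟶ X⟦(1 : ℤ)⟧}
    (hA : Triangle.mk (0 : X ⟶ Y) i p ∈ distTriang C) :
    ∃ (r : A ⟶ Y) (s : X⟦(1 : ℤ)⟧ ⟶ A),
      i ≫ r = 𝟙 Y ∧ s ≫ p = 𝟙 _ ∧ r ≫ i + p ≫ s = 𝟙 A := by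
  have hsplit : ∃ e : A ≅ Y ⊞ X⟦(1 : ℤ)⟧, i ≫ e.hom = biprod.inl ∧ p = e.hom ≫ biprod.snd :=
    exists_iso_binaryBiproduct_of_distTriang _ (rot_of_distTriang _ hA) (by
      change -((0 : X ⟶ Y)⟦(1 : ℤ)⟧') = 0
      rw [Functor.map_zero, neg_zero])
  obtain ⟨e, he₁, he₂⟩ := hsplit
  refine ⟨e.hom ≫ biprod.fst, biprod.inr ≫ e.inv, ?_, ?_, ?_⟩
  · rw [← assoc, he₁, biprod.inl_fst]
  · rw [he₂]; simp
  · rw [← cancel_epi e.inv, ← cancel_mono e.hom, he₂]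
    simp only [Preadditive.comp_add, Preadditive.add_comp, assoc, he₁]
    ext <;> simp

lemma isOctahedron_comp_iso {A₁ A₂ A₃ B₁ B₂ B₃ : C} {a : A₁ ⟶ A₂} {b : A₂ ⟶ A₃}
    {p₁ : A₂ ⟶ B₁} {q₁ : B₁ ⟶ A₁⟦(1 : ℤ)⟧}
    {p₂ : A₃ ⟶ B₂} {q₂ : B₂ ⟶ A₂⟦(1 : ℤ)⟧}
    {p₃ : A₃ ⟶ B₃} {q₃ : B₃ ⟶ A₁⟦(1 : ℤ)⟧}
    {m : B₁ ⟶ B₃} {n : B₃ ⟶ B₂} (ho : IsOctahedron a b p₁ q₁ p₂ q₂ p₃ q₃ m n)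
    (e : B₃ ≅ B₃) (hp : p₃ ≫ e.hom = p₃) (hq : e.hom ≫ q₃ = q₃) :
    IsOctahedron a b p₁ q₁ p₂ q₂ p₃ q₃ (m ≫ e.hom) (e.inv ≫ n) := by
  obtain ⟨h₁, h₂, h₃, h₄, h₅⟩ := ho
  refine ⟨?_, ?_, ?_, ?_, ?_⟩
  · rw [← assoc, h₁, assoc, hp]
  · rw [assoc, hq, h₂]
  · rw [← assoc, ← (Iso.eq_comp_inv e).2 hp, h₃]
  · rw [assoc, h₄, ← assoc, ← (Iso.eq_inv_comp e).2 hq]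
  · exact isomorphic_distinguished _ h₅ _
      (Triangle.isoMk _ _ (Iso.refl B₁) e.symm (Iso.refl B₂)
        (by change (m ≫ e.hom) ≫ e.inv = 𝟙 B₁ ≫ m; simp)
        (by change (e.inv ≫ n) ≫ 𝟙 B₂ = e.inv ≫ n; simp)
        (by
          change (q₂ ≫ p₁⟦(1 : ℤ)⟧') ≫ (𝟙 B₁)⟦(1 : ℤ)⟧' = 𝟙 B₂ ≫ q₂ ≫ p₁⟦(1 : ℤ)⟧'
          simp))

lemma exists_isOctahedron {A₁ A₂ A₃ B₁ B₂ B₃ : C} {a : A₁ ⟶ A₂} {b : A₂ ⟶ A₃} {c : A₁ ⟶ A₃}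
    {p₁ : A₂ ⟶ B₁} {q₁ : B₁ ⟶ A₁⟦(1 : ℤ)⟧}
    {p₂ : A₃ ⟶ B₂} {q₂ : B₂ ⟶ A₂⟦(1 : ℤ)⟧}
    {p₃ : A₃ ⟶ B₃} {q₃ : B₃ ⟶ A₁⟦(1 : ℤ)⟧} (hc : a ≫ b = c)
    (h₁ : Triangle.mk a p₁ q₁ ∈ distTriang C) (h₂ : Triangle.mk b p₂ q₂ ∈ distTriang C)
    (h₃ : Triangle.mk c p₃ q₃ ∈ distTriang C) :
    ∃ (m : B₁ ⟶ B₃) (n : B₃ ⟶ B₂), IsOctahedron a b p₁ q₁ p₂ q₂ p₃ q₃ m n :=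
  let o := Triangulated.someOctahedron hc h₁ h₂ h₃
  ⟨o.m₁, o.m₃, o.comm₁, o.comm₂, o.comm₃, o.comm₄.symm, o.mem⟩

/-- The automorphism `1 + p ≫ c ≫ i` attached to a composable pair `i`, `p` with zero composite. -/
@[simps]
def isoAddOfCompEqZero {A Y Z : C} (i : Y ⟶ A) (p : A ⟶ Z) (hip : i ≫ p = 0) (c : Z ⟶ Y) :
    A ≅ A where
  hom := 𝟙 A + p ≫ c ≫ i
  inv := 𝟙 A - p ≫ c ≫ i
  hom_inv_id := by simp [reassoc_of% hip]
  inv_hom_id := by simp [reassoc_of% hip]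

variable {T T' : Triangle C} {f : T.obj₁ ⟶ T'.obj₁} {g : T.obj₂ ⟶ T'.obj₂}
  {h : T.obj₃ ⟶ T'.obj₃}

lemma isNullHomotopic_of_isVerdierGood (hug : T.mor₁ ≫ g = 0)
    (hV : IsVerdierGood T T' f g h) : IsNullHomotopic T T' f g h := by
  obtain ⟨A, _, _, i, p, _, _, _, _, α₁, _, _, β₂, hA, _, _, ⟨a₁, a₂, -⟩, ⟨-, -, b₃, b₄, -⟩, rfl⟩ :=
    hV
  rw [hug] at hA
  obtain ⟨r, s, hr, hs, hrs⟩ := exists_splitting_of_distinguished_zero hA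
  refine ⟨0, α₁ ≫ r, s ≫ β₂, ?_, ?_, ?_⟩
  · rw [assoc, b₄, ← assoc, hs]
    simp
  · rw [← assoc, a₁, assoc, hr]
    simp
  · have := α₁ ≫= hrs =≫ β₂
    simp only [Preadditive.comp_add, Preadditive.add_comp, assoc, b₃, reassoc_of% a₂,
      id_comp] at this
    rw [assoc, ← this, add_comm]

lemma isVerdierGood_of_homotopy (hT : T ∈ distTriang C) (hT' : T' ∈ distTriang C)
    (hug : T.mor₁ ≫ g = 0) (hfu : f ≫ T'.mor₁ = 0)
    {G : T.obj₃ ⟶ T'.obj₂} {H : T.obj₁⟦(1 : ℤ)⟧ ⟶ T'.obj₃}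
    (hH : f⟦(1 : ℤ)⟧' = H ≫ T'.mor₃) (hG : g = T.mor₂ ≫ G)
    (hh : h = T.mor₃ ≫ H + G ≫ T'.mor₂) : IsVerdierGood T T' f g h := by
  obtain ⟨A, i, p, hA⟩ := distinguished_cocone_triangle (0 : T.obj₁ ⟶ T'.obj₂)
  obtain ⟨Y'', g', g'', hg⟩ := distinguished_cocone_triangle g
  obtain ⟨X'', f', f'', hf⟩ := distinguished_cocone_triangle f
  have hip : i ≫ p = 0 := comp_distTriang_mor_zero₂₃ _ hA
  obtain ⟨r, s, hr, hs, hrs⟩ := exists_splitting_of_distinguished_zero hA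
  obtain ⟨α₁, β₁, o₁⟩ := exists_isOctahedron hug hT hg hA
  obtain ⟨α₂, β₂, o₂⟩ := exists_isOctahedron hfu hf hT' hA
  obtain ⟨c, hc⟩ := T.yoneda_exact₃ hT (G - α₁ ≫ r) (by
    rw [Preadditive.comp_sub, ← assoc, o₁.1, assoc, hr, comp_id, hG, sub_self])
  obtain ⟨d, hd⟩ := T'.coyoneda_exact₃ hT' (s ≫ β₂ - H) (by
    rw [Preadditive.sub_comp, assoc, o₂.2.2.2.1, ← assoc, hs, id_comp, hH, sub_self])
  let e := isoAddOfCompEqZero i p hip c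
  let e' := isoAddOfCompEqZero i p hip d
  have hie : ∀ c, i ≫ (isoAddOfCompEqZero i p hip c).hom = i := fun c => by
    simp [reassoc_of% hip]
  have hep : ∀ c, (isoAddOfCompEqZero i p hip c).hom ≫ p = p := fun c => by
    simp [hip]
  refine ⟨A, Y'', X'', i, p, g', g'', f', f'', α₁ ≫ e.hom, e.inv ≫ β₁, α₂ ≫ e'.hom,
    e'.inv ≫ β₂, by rwa [hug], hg, hf, isOctahedron_comp_iso o₁ e (hie c) (hep c),
    isOctahedron_comp_iso o₂ e' (hie d) (hep d), ?_⟩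
  have hα : α₁ = (α₁ ≫ r) ≫ i + T.mor₃ ≫ s := by
    have := α₁ ≫= hrs
    simp only [Preadditive.comp_add, ← assoc, o₁.2.1, comp_id] at this
    simpa using this.symm
  have h₁ : α₁ ≫ e.hom = G ≫ i + T.mor₃ ≫ s := by
    have : α₁ ≫ e.hom = α₁ + T.mor₃ ≫ c ≫ i := by
      simp [e, reassoc_of% o₁.2.1]
    rw [this, ← assoc, ← hc]
    nth_rw 1 [hα]
    rw [Preadditive.sub_comp]
    abel
  have h₂ : i ≫ e'.inv ≫ β₂ = T'.mor₂ := by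
    simp [e', reassoc_of% hip, o₂.2.2.1]
  have h₃ : s ≫ e'.inv ≫ β₂ = H := by
    have : s ≫ e'.inv ≫ β₂ = s ≫ β₂ - d ≫ T'.mor₂ := by
      simp [e', reassoc_of% hs, o₂.2.2.1]
    rw [this, ← hd, sub_sub_cancel]
  rw [h₁, Preadditive.add_comp, assoc, assoc, h₂, h₃, hh, add_comm]

end VerdierGood

theorem stmt_16 {X Y Z X' Y' Z' : C}
    (u : X ⟶ Y) (v : Y ⟶ Z) (w : Z ⟶ X⟦(1 : ℤ)⟧)
    (u' : X' ⟶ Y') (v' : Y' ⟶ Z') (w' : Z' ⟶ X'⟦(1 : ℤ)⟧)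
    (hT : Triangle.mk u v w ∈ distTriang C)
    (hT' : Triangle.mk u' v' w' ∈ distTriang C)
    (f : X ⟶ X') (g : Y ⟶ Y') (h : Z ⟶ Z')
    (hmap : IsTriMap (Triangle.mk u v w) (Triangle.mk u' v' w') f g h)
    (hzero : f = 0 ∨ g = 0 ∨ h = 0) :
    (IsNullHomotopic (Triangle.mk u v w) (Triangle.mk u' v' w') f g h ↔ IsGood (Triangle.mk u v w) (Triangle.mk u' v' w') f g h) ∧
    ((f = 0 ∨ g = 0) →
      (IsNullHomotopic (Triangle.mk u v w) (Triangle.mk u' v' w') f g h ↔ IsVerdierGood (Triangle.mk u v w) (Triangle.mk u' v' w') f g h)) := by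
  have hnull : (f = 0 ∨ g = 0) → u ≫ g = 0 ∧ f ≫ u' = 0 := by
    have h₁ : u ≫ g = f ≫ u' := hmap.1
    rintro (rfl | rfl)
    · simpa using h₁
    · simpa using h₁.symm
  have hiff : (f = 0 ∨ g = 0) →
      (IsNullHomotopic (Triangle.mk u v w) (Triangle.mk u' v' w') f g h ↔
        IsGood (Triangle.mk u v w) (Triangle.mk u' v' w') f g h) := fun hfg =>
    isNullHomotopic_iff_isGood_of_zero_diagonal hT hT' (hnull hfg).1 (hnull hfg).2
  refine ⟨?_, fun hfg => ⟨fun hn => ?_, isNullHomotopic_of_isVerdierGood (hnull hfg).1⟩⟩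
  · obtain hf | hg | rfl := hzero
    · exact hiff (Or.inl hf)
    · exact hiff (Or.inr hg)
    · have h₂ : v ≫ 0 = g ≫ v' := hmap.2.1
      exact isNullHomotopic_iff_isGood_of_third_zero hT hT' (h₂.symm.trans comp_zero)
  · obtain ⟨G, H, e₁, e₂, e₃⟩ :=
      exists_homotopy_of_isGood hT hT' (hnull hfg).1 (hnull hfg).2 ((hiff hfg).1 hn)
    exact isVerdierGood_of_homotopy hT hT' (hnull hfg).1 (hnull hfg).2 e₁ e₂ e₃
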